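/- If the system ẋ = Ax + f(x, u) over a Banach space X, with f bi-Lipschitz on bounded sets, is input-to-state stable (ISS), then it is weakly uniformly robustly asymptotically stable (WURS): there exist a feedback map φ : X → [0,∞) Lipschitz continuous on bounded balls and ψ ∈ K∞ with φ(x) ≥ ψ(‖x‖_X) for all x ∈ X, and β ∈ KL, such that every mild solution φ_φ(t,x,d) of the closed-loop system ẋ = Ax + f(x, d(t)φ(x)) with piecewise continuous disturbance d satisfying ‖d(t)‖_U ≤ 1 exists globally and satisfies ‖φ_φ(t,x,d)‖_X ≤ β(‖x‖_X, t) for all t ≥ 0. -/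

import Mathlib

open Set Filter Topology MeasureTheory

section Defs

variable {X : Type*} [NormedAddCommGroup X] [NormedSpace ℝ X] [CompleteSpace X]
variable {U : Type*} [NormedAddCommGroup U] [NormedSpace ℝ U]

/-- Class `K` functions: continuous, strictly increasing on `[0,∞)` and vanishing at `0`. -/
def ClassK (γ : ℝ → ℝ) : Prop :=
  ContinuousOn γ (Ici 0) ∧ StrictMonoOn γ (Ici 0) ∧ γ 0 = 0

/-- Class `K∞` functions: class `K` and unbounded. -/
def ClassKinf (γ : ℝ → ℝ) : Prop :=
  ClassK γ ∧ ∀ M : ℝ, ∃ r : ℝ, 0 ≤ r ∧ M < γ r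

/-- Class `KL` functions. -/
def ClassKL (β : ℝ → ℝ → ℝ) : Prop :=
  ContinuousOn (fun p : ℝ × ℝ => β p.1 p.2) (Ici 0 ×ˢ Ici 0) ∧
  (∀ t : ℝ, 0 ≤ t → ClassK (fun r => β r t)) ∧
  (∀ r : ℝ, 0 < r →
    StrictAntiOn (fun t => β r t) (Ici 0) ∧ Tendsto (fun t => β r t) atTop (nhds 0))

/-- Continuous positive definite functions on `[0,∞)`. -/
def ClassPD (α : ℝ → ℝ) : Prop :=
  ContinuousOn α (Ici 0) ∧ α 0 = 0 ∧ ∀ r : ℝ, 0 < r → 0 < α r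

/-- A strongly continuous semigroup of bounded linear operators on `X`,
parametrized by `t : ℝ` (only the values for `t ≥ 0` matter). -/
def IsC0Semigroup (T : ℝ → X →L[ℝ] X) : Prop :=
  T 0 = 1 ∧ (∀ s : ℝ, 0 ≤ s → ∀ t : ℝ, 0 ≤ t → T (s + t) = (T s).comp (T t)) ∧
  ∀ x : X, ContinuousOn (fun t => T t x) (Ici 0)

/-- Piecewise continuous functions: on each compact interval, continuous up to
finitely many exceptional points. -/
def PiecewiseContinuous (u : ℝ → U) : Prop :=
  ∀ a b : ℝ, ∃ S : Finset ℝ, ∀ t ∈ Icc a b, t ∉ S → ContinuousAt u t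

/-- Admissible inputs: globally bounded (on `[0,∞)`) piecewise continuous functions. -/
def AdmissibleInput (u : ℝ → U) : Prop :=
  PiecewiseContinuous u ∧ ∃ C : ℝ, ∀ t : ℝ, 0 ≤ t → ‖u t‖ ≤ C

/-- Admissible disturbances: piecewise continuous functions with values in the
closed unit ball of `U`. -/
def AdmissibleDisturbance (d : ℝ → U) : Prop :=
  PiecewiseContinuous d ∧ ∀ t : ℝ, 0 ≤ t → ‖d t‖ ≤ 1

/-- The sup-norm of an input over `[0,∞)`. -/
noncomputable def supNorm (u : ℝ → U) : ℝ := ⨆ t : Ici (0:ℝ), ‖u ↑t‖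

/-- Mild solutions of `ẋ = Ax + f(x,u)`:
`φ(t) = T_t x₀ + ∫_0^t T_{t-s} f(φ(s), u(s)) ds`, continuous on `[0,∞)`. -/
def IsMildSolution (T : ℝ → X →L[ℝ] X) (f : X → U → X) (x₀ : X) (u : ℝ → U)
    (φ : ℝ → X) : Prop :=
  φ 0 = x₀ ∧ ContinuousOn φ (Ici 0) ∧
  ∀ t : ℝ, 0 ≤ t → φ t = T t x₀ + ∫ s in (0:ℝ)..t, T (t - s) (f (φ s) (u s))

/-- `f : X × U → X` is bi-Lipschitz continuous on bounded sets. -/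
def BiLipschitzOnBounded (f : X → U → X) : Prop :=
  (∀ C : ℝ, 0 < C → ∃ L : ℝ, 0 < L ∧ ∀ x y : X, ‖x‖ ≤ C → ‖y‖ ≤ C → ∀ v : U,
      ‖f x v - f y v‖ ≤ L * ‖x - y‖) ∧
  (∀ C : ℝ, 0 < C → ∃ L : ℝ, 0 < L ∧ ∀ u v : U, ‖u‖ ≤ C → ‖v‖ ≤ C → ∀ x : X,
      ‖f x u - f x v‖ ≤ L * ‖u - v‖)

/-- Lipschitz continuity on bounded balls. -/
def LipschitzOnBoundedBalls {Y : Type*} [NormedAddCommGroup Y] (V : X → Y) : Prop :=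
  ∀ r : ℝ, 0 < r → ∃ L : ℝ, 0 < L ∧ ∀ x y : X, ‖x‖ ≤ r → ‖y‖ ≤ r →
    ‖V x - V y‖ ≤ L * ‖x - y‖

/-- The (upper right) Dini derivative of `V` along a trajectory `ψ`, at the point `x`. -/
noncomputable def DiniDerivAlong (V : X → ℝ) (ψ : ℝ → X) (x : X) : EReal :=
  Filter.limsup (fun t : ℝ => (((V (ψ t) - V x) / t : ℝ) : EReal)) (nhdsWithin 0 (Ioi 0))

/-- Input-to-state stability of `ẋ = Ax + f(x,u)`: forward completeness plus
a `KL`/`K` estimate on all mild solutions. -/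
def ISSProp (T : ℝ → X →L[ℝ] X) (f : X → U → X) : Prop :=
  (∀ (x : X) (u : ℝ → U), AdmissibleInput u → ∃ ψs : ℝ → X, IsMildSolution T f x u ψs) ∧
  ∃ (β : ℝ → ℝ → ℝ) (γ : ℝ → ℝ), ClassKL β ∧ ClassK γ ∧
    ∀ (x : X) (u : ℝ → U) (ψs : ℝ → X), AdmissibleInput u → IsMildSolution T f x u ψs →
      ∀ t : ℝ, 0 ≤ t → ‖ψs t‖ ≤ β ‖x‖ t + γ (supNorm u)

/-- Weak uniform robust asymptotic stability of `ẋ = Ax + f(x,u)`: there is a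
feedback `φfb ≥ ψ(‖·‖)`, Lipschitz on bounded balls, such that the closed-loop
system `ẋ = Ax + f(x, d(t)·φfb(x))` is forward complete and UGAS, uniformly over
all piecewise continuous disturbances with values in the unit ball. -/
def WURSProp (T : ℝ → X →L[ℝ] X) (f : X → U → X) : Prop :=
  ∃ (φfb : X → ℝ) (ψ : ℝ → ℝ) (β : ℝ → ℝ → ℝ),
    (∀ x : X, 0 ≤ φfb x) ∧ LipschitzOnBoundedBalls φfb ∧ ClassKinf ψ ∧
    (∀ x : X, ψ ‖x‖ ≤ φfb x) ∧ ClassKL β ∧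
    ∀ (x : X) (d : ℝ → U), AdmissibleDisturbance d →
      (∃ ψs : ℝ → X, IsMildSolution T (fun z v => f z (φfb z • v)) x d ψs) ∧
      ∀ ψs : ℝ → X, IsMildSolution T (fun z v => f z (φfb z • v)) x d ψs →
        ∀ t : ℝ, 0 ≤ t → ‖ψs t‖ ≤ β ‖x‖ t

/-- Existence of a coercive ISS Lyapunov function (in implication form) which is
Lipschitz continuous on bounded balls. -/
def CoerciveISSLF (T : ℝ → X →L[ℝ] X) (f : X → U → X) : Prop :=
  ∃ (V : X → ℝ) (ψ₁ ψ₂ χ α : ℝ → ℝ),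
    LipschitzOnBoundedBalls V ∧ ClassKinf ψ₁ ∧ ClassKinf ψ₂ ∧ ClassK χ ∧ ClassPD α ∧
    (∀ x : X, ψ₁ ‖x‖ ≤ V x ∧ V x ≤ ψ₂ ‖x‖) ∧
    ∀ (x : X) (u : ℝ → U), AdmissibleInput u → χ ‖u 0‖ ≤ ‖x‖ →
      ∀ ψs : ℝ → X, IsMildSolution T f x u ψs →
        DiniDerivAlong V ψs x ≤ ((-α ‖x‖ : ℝ) : EReal)

end Defs

section MildSolutions

variable {X : Type*} [NormedAddCommGroup X]
variable {U : Type*} [NormedAddCommGroup U]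

theorem PiecewiseContinuous.aestronglyMeasurable {u : ℝ → U} (hu : PiecewiseContinuous u) :
    AEStronglyMeasurable u volume := by
  have hD : {t : ℝ | ¬ ContinuousAt u t}.Countable := by
    choose S hS using fun n : ℕ => hu (-n) n
    refine (countable_iUnion fun n => (S n).countable_toSet).mono fun t ht => ?_
    obtain ⟨n, hn⟩ := exists_nat_ge |t|
    refine mem_iUnion.2 ⟨n, ?_⟩
    by_contra hmem
    exact ht (hS n t (abs_le.1 hn) hmem)
  set D := {t : ℝ | ¬ ContinuousAt u t}
  have hcont : ContinuousOn u Dᶜ := fun t ht =>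
    (not_not.1 (show ¬ ¬ ContinuousAt u t from ht)).continuousWithinAt
  have h := hcont.aestronglyMeasurable (μ := volume) hD.measurableSet.compl
  rwa [Measure.restrict_eq_self_of_ae_mem (show ∀ᵐ t, t ∈ Dᶜ from hD.ae_notMem volume)] at h

theorem BiLipschitzOnBounded.continuous {f : X → U → X} (hf : BiLipschitzOnBounded f) :
    Continuous fun p : X × U => f p.1 p.2 := by
  rw [continuous_iff_continuousAt]
  rintro ⟨x₀, u₀⟩
  obtain ⟨L₁, -, hL₁⟩ := hf.1 (‖x₀‖ + 1) (by positivity)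
  obtain ⟨L₂, -, hL₂⟩ := hf.2 (‖u₀‖ + 1) (by positivity)
  rw [ContinuousAt, tendsto_iff_norm_sub_tendsto_zero]
  have hlim : Tendsto (fun p : X × U => L₁ * ‖p.1 - x₀‖ + L₂ * ‖p.2 - u₀‖) (𝓝 (x₀, u₀)) (𝓝 0) := by
    have : Continuous fun p : X × U => L₁ * ‖p.1 - x₀‖ + L₂ * ‖p.2 - u₀‖ := by fun_prop
    simpa using this.tendsto (x₀, u₀)
  refine squeeze_zero' (Eventually.of_forall fun p => norm_nonneg _) ?_ hlim
  have h1 : ∀ᶠ p : X × U in 𝓝 (x₀, u₀), ‖p.1‖ < ‖x₀‖ + 1 :=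
    (continuous_fst.norm.tendsto (x₀, u₀)).eventually_lt_const (by simp)
  have h2 : ∀ᶠ p : X × U in 𝓝 (x₀, u₀), ‖p.2‖ < ‖u₀‖ + 1 :=
    (continuous_snd.norm.tendsto (x₀, u₀)).eventually_lt_const (by simp)
  filter_upwards [h1, h2] with p hp1 hp2
  calc ‖f p.1 p.2 - f x₀ u₀‖
      ≤ ‖f p.1 p.2 - f x₀ p.2‖ + ‖f x₀ p.2 - f x₀ u₀‖ := norm_sub_le_norm_sub_add_norm_sub _ _ _
    _ ≤ _ := add_le_add (hL₁ _ _ hp1.le (by linarith) _) (hL₂ _ _ hp2.le (by linarith) _)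

theorem BiLipschitzOnBounded.exists_bound {f : X → U → X} (hf : BiLipschitzOnBounded f) (C : ℝ) :
    ∃ B, ∀ x u, ‖x‖ ≤ C → ‖u‖ ≤ C → ‖f x u‖ ≤ B := by
  obtain ⟨L₁, hL₁0, hL₁⟩ := hf.1 (|C| + 1) (by positivity)
  obtain ⟨L₂, hL₂0, hL₂⟩ := hf.2 (|C| + 1) (by positivity)
  refine ⟨L₁ * C + L₂ * C + ‖f 0 0‖, fun x u hx hu => ?_⟩
  have hC := le_abs_self C
  have h1 := hL₁ x 0 (by linarith) (by simp; positivity) u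
  have h2 := hL₂ u 0 (by linarith) (by simp; positivity) 0
  rw [sub_zero] at h1 h2
  calc ‖f x u‖ = ‖(f x u - f 0 u) + (f 0 u - f 0 0) + f 0 0‖ := by congr 1; abel
    _ ≤ ‖f x u - f 0 u‖ + ‖f 0 u - f 0 0‖ + ‖f 0 0‖ := norm_add₃_le
    _ ≤ L₁ * ‖x‖ + L₂ * ‖u‖ + ‖f 0 0‖ := by gcongr
    _ ≤ _ := by gcongr

namespace IsC0Semigroup

variable [NormedSpace ℝ X] {T : ℝ → X →L[ℝ] X}

theorem norm_convolution_le {M ω : ℝ} (hM : 0 ≤ M)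
    (hb : ∀ t, 0 ≤ t → ‖T t‖ ≤ M * Real.exp (ω * t)) {h : ℝ → X} {C l t : ℝ} (hC : 0 ≤ C)
    (hl : ω < l) (ht : 0 ≤ t) (hh : ∀ s ∈ Icc 0 t, ‖h s‖ ≤ C * Real.exp (l * s)) :
    ‖∫ s in (0 : ℝ)..t, T (t - s) (h s)‖ ≤ M * C / (l - ω) * Real.exp (l * t) := by
  have hpos : 0 < l - ω := sub_pos.2 hl
  have hd : ∀ s : ℝ, HasDerivAt
      (fun s => M * C / (l - ω) * Real.exp (ω * (t - s) + l * s))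
      (M * C * Real.exp (ω * (t - s) + l * s)) s := by
    intro s
    have h1 : HasDerivAt (fun s : ℝ => ω * (t - s) + l * s) (ω * (-1) + l * 1) s :=
      (((hasDerivAt_id s).const_sub t).const_mul ω).add ((hasDerivAt_id s).const_mul l)
    refine (h1.exp.const_mul (M * C / (l - ω))).congr_deriv ?_
    field_simp
    ring
  have hint : IntervalIntegrable (fun s => M * C * Real.exp (ω * (t - s) + l * s)) volume 0 t :=
    (by fun_prop :
      Continuous fun s => M * C * Real.exp (ω * (t - s) + l * s)).intervalIntegrable _ _
  have hle := intervalIntegral.norm_integral_le_of_norm_le ht (μ := volume)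
    (f := fun s => T (t - s) (h s)) (Eventually.of_forall fun s hs => by
      refine ((T (t - s)).le_of_opNorm_le_of_le (hb _ (sub_nonneg.2 hs.2))
        (hh s ⟨hs.1.le, hs.2⟩)).trans_eq ?_
      rw [Real.exp_add]
      ring : ∀ᵐ s : ℝ, s ∈ Ioc 0 t → _ ≤ M * C * Real.exp (ω * (t - s) + l * s)) hint
  refine hle.trans ?_
  rw [intervalIntegral.integral_eq_sub_of_hasDerivAt (fun s _ => hd s) hint]
  simp only [sub_self, mul_zero, zero_add]
  have : 0 ≤ M * C / (l - ω) * Real.exp (ω * (t - 0) + 0) := by positivity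
  linarith

variable [CompleteSpace X]

theorem exists_growth_bound (hT : IsC0Semigroup T) :
    ∃ M ω : ℝ, 1 ≤ M ∧ 0 ≤ ω ∧ ∀ t, 0 ≤ t → ‖T t‖ ≤ M * Real.exp (ω * t) := by
  obtain ⟨-, hadd, hcont⟩ := hT
  obtain ⟨C, hC⟩ : ∃ C, ∀ t : Icc (0 : ℝ) 1, ‖T t‖ ≤ C := by
    refine banach_steinhaus fun x => ?_
    obtain ⟨C, hC⟩ := isCompact_Icc.exists_bound_of_continuousOn
      ((hcont x).mono (Icc_subset_Ici_self : Icc (0 : ℝ) 1 ⊆ Ici 0))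
    exact ⟨C, fun t => hC t t.2⟩
  set M := max C 1
  have hM : 1 ≤ M := le_max_right _ _
  have hM1 : ∀ t, 0 ≤ t → t ≤ 1 → ‖T t‖ ≤ M := fun t h0 h1 =>
    (hC ⟨t, h0, h1⟩).trans (le_max_left _ _)
  have hnat : ∀ n : ℕ, ∀ t, 0 ≤ t → t ≤ 1 → ‖T (n + t)‖ ≤ M * M ^ n := by
    intro n
    induction n with
    | zero => intro t h0 h1; simpa using hM1 t h0 h1
    | succ n ih =>
      intro t h0 h1
      have h : T ((n + 1 : ℕ) + t) = (T 1).comp (T (n + t)) := by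
        rw [← hadd 1 zero_le_one (n + t) (by positivity)]
        congr 1
        push_cast
        ring
      rw [h, pow_succ]
      calc ‖(T 1).comp (T (n + t))‖ ≤ ‖T 1‖ * ‖T (n + t)‖ := ContinuousLinearMap.opNorm_comp_le _ _
        _ ≤ M * (M * M ^ n) :=
          mul_le_mul (hM1 1 zero_le_one le_rfl) (ih t h0 h1) (norm_nonneg _) (by positivity)
        _ = _ := by ring
  refine ⟨M, Real.log M, hM, Real.log_nonneg hM, fun t ht => ?_⟩
  have h := hnat ⌊t⌋₊ (t - ⌊t⌋₊) (sub_nonneg.2 (Nat.floor_le ht))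
    (by linarith [Nat.lt_floor_add_one t])
  rw [add_sub_cancel] at h
  refine h.trans (mul_le_mul_of_nonneg_left ?_ (by positivity))
  rw [← Real.rpow_natCast, Real.rpow_def_of_pos (by positivity)]
  exact Real.exp_le_exp.2 (mul_le_mul_of_nonneg_left (Nat.floor_le ht) (Real.log_nonneg hM))

theorem continuous_uncurry (hT : IsC0Semigroup T) :
    Continuous fun p : ℝ × X => T (max p.1 0) p.2 := by
  obtain ⟨M, ω, hM, hω, hb⟩ := hT.exists_growth_bound
  rw [continuous_iff_continuousAt]
  rintro ⟨t₀, x₀⟩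
  have hx₀ : Continuous fun t : ℝ => T (max t 0) x₀ :=
    (hT.2.2 x₀).comp_continuous (by fun_prop) fun t => le_max_right t 0
  have h2 : Tendsto (fun p : ℝ × X => T (max p.1 0) x₀) (𝓝 (t₀, x₀)) (𝓝 (T (max t₀ 0) x₀)) :=
    (hx₀.comp continuous_fst).tendsto (t₀, x₀)
  have h1 : Tendsto (fun p : ℝ × X => T (max p.1 0) (p.2 - x₀)) (𝓝 (t₀, x₀)) (𝓝 0) := by
    have hlim : Tendsto (fun p : ℝ × X => M * Real.exp (ω * max p.1 0) * ‖p.2 - x₀‖)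
        (𝓝 (t₀, x₀)) (𝓝 0) := by
      have : Continuous fun p : ℝ × X => M * Real.exp (ω * max p.1 0) * ‖p.2 - x₀‖ := by fun_prop
      simpa using this.tendsto (t₀, x₀)
    exact squeeze_zero_norm (fun p => (T _).le_of_opNorm_le (hb _ (le_max_right _ _)) _) hlim
  have h := h1.add h2
  simp only [map_sub, sub_add_cancel, zero_add] at h
  exact h

theorem aestronglyMeasurable_kernel (hT : IsC0Semigroup T) {h : ℝ → X}
    (hh : AEStronglyMeasurable h volume) (t : ℝ) :
    AEStronglyMeasurable (fun s => T (max (t - s) 0) (h s)) volume :=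
  hT.continuous_uncurry.comp_aestronglyMeasurable
    ((by fun_prop : Continuous fun s : ℝ => t - s).aestronglyMeasurable.prodMk hh)

theorem intervalIntegrable_kernel (hT : IsC0Semigroup T) {h : ℝ → X}
    (hh : AEStronglyMeasurable h volume) {t C : ℝ} (ht : 0 ≤ t)
    (hC : ∀ s ∈ Icc 0 t, ‖h s‖ ≤ C) :
    IntervalIntegrable (fun s => T (t - s) (h s)) volume 0 t := by
  obtain ⟨M, ω, hM, hω, hb⟩ := hT.exists_growth_bound
  rw [intervalIntegrable_iff_integrableOn_Ioc_of_le ht]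
  refine Integrable.mono' (g := fun _ => M * Real.exp (ω * t) * C) (integrable_const _) ?_ ?_
  · refine (hT.aestronglyMeasurable_kernel hh t).restrict.congr ?_
    refine ae_restrict_of_forall_mem measurableSet_Ioc fun s hs => ?_
    simp only [max_eq_left (sub_nonneg.2 hs.2)]
  · refine ae_restrict_of_forall_mem measurableSet_Ioc fun s hs => ?_
    refine (T (t - s)).le_of_opNorm_le_of_le ((hb _ (sub_nonneg.2 hs.2)).trans ?_)
      (hC s ⟨hs.1.le, hs.2⟩)
    gcongr
    linarith [hs.1]

theorem continuous_convolution (hT : IsC0Semigroup T) {h : ℝ → X}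
    (hh : AEStronglyMeasurable h volume) {C : ℝ} (hC : ∀ s, ‖h s‖ ≤ C) :
    Continuous fun t => ∫ s in (0 : ℝ)..t, T (max (t - s) 0) (h s) := by
  obtain ⟨M, ω, hM, hω, hb⟩ := hT.exists_growth_bound
  rw [continuous_iff_continuousAt]
  intro t₀
  have ha := abs_nonneg t₀
  have h2 := neg_abs_le t₀
  have h3 := le_abs_self t₀
  have key := intervalIntegral.continuousAt_parametric_primitive_of_dominated (μ := volume)
    (F := fun t s => T (max (t - s) 0) (h s)) (x₀ := t₀) (a₀ := 0) (b₀ := t₀)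
    (fun _ => M * Real.exp (ω * (2 * |t₀| + 2)) * C) (-|t₀| - 1) (|t₀| + 1)
    (fun t => (hT.aestronglyMeasurable_kernel hh t).restrict) ?_ intervalIntegrable_const ?_
    ⟨by linarith, by linarith⟩ ⟨by linarith, by linarith⟩ (by simp)
  · exact key.comp (f := fun t => (t, t)) (by fun_prop)
  · filter_upwards [Iio_mem_nhds (show t₀ < |t₀| + 1 by linarith)] with t ht
    refine ae_restrict_of_forall_mem measurableSet_uIoc fun s hs => ?_
    rw [uIoc_of_le (by linarith)] at hs
    refine (T _).le_of_opNorm_le_of_le ((hb _ (le_max_right _ _)).trans ?_) (hC s)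
    gcongr
    exact max_le (by linarith [hs.1, mem_Iio.1 ht]) (by linarith)
  · refine Eventually.of_forall fun s => ?_
    exact (hT.continuous_uncurry.comp
      (by fun_prop : Continuous fun t : ℝ => (t - s, h s))).continuousAt

theorem convolution_add (hT : IsC0Semigroup T) {h : ℝ → X}
    (hh : AEStronglyMeasurable h volume) {a t C : ℝ} (ha : 0 ≤ a) (ht : 0 ≤ t)
    (hC : ∀ s ∈ Icc 0 (a + t), ‖h s‖ ≤ C) :
    ∫ s in (0 : ℝ)..(a + t), T (a + t - s) (h s) =
      T t (∫ s in (0 : ℝ)..a, T (a - s) (h s)) + ∫ s in (0 : ℝ)..t, T (t - s) (h (a + s)) := by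
  have hint := hT.intervalIntegrable_kernel hh (add_nonneg ha ht) hC
  have hinta := hT.intervalIntegrable_kernel hh ha fun s hs => hC s ⟨hs.1, by linarith [hs.2]⟩
  rw [← intervalIntegral.integral_add_adjacent_intervals (b := a)
    (hint.mono_set (by rw [uIcc_of_le ha, uIcc_of_le (by positivity)]; gcongr; linarith))
    (hint.mono_set (by rw [uIcc_of_le (by linarith), uIcc_of_le (by positivity)]; gcongr)),
    ← ContinuousLinearMap.intervalIntegral_comp_comm _ hinta]
  congr 1
  · refine intervalIntegral.integral_congr fun s hs => ?_
    rw [uIcc_of_le ha] at hs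
    have : a + t - s = t + (a - s) := by ring
    simp only [this, hT.2.1 t ht (a - s) (sub_nonneg.2 hs.2), ContinuousLinearMap.comp_apply]
  · have := intervalIntegral.integral_comp_add_left (a := 0) (b := t)
      (fun s => T (a + t - s) (h s)) a
    simpa only [add_zero, add_sub_add_left_eq_sub] using this.symm

theorem exists_mild_solution (hT : IsC0Semigroup T) {G : ℝ → X → X} {B L : ℝ}
    (hB : ∀ s z, ‖G s z‖ ≤ B) (hL0 : 0 ≤ L) (hL : ∀ s z z', ‖G s z - G s z'‖ ≤ L * ‖z - z'‖)
    (hG : ∀ y : ℝ → X, Continuous y → AEStronglyMeasurable (fun s => G s (y s)) volume) (x : X) :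
    ∃ y : ℝ → X, Continuous y ∧
      ∀ t, 0 ≤ t → y t = T t x + ∫ s in (0 : ℝ)..t, T (t - s) (G s (y s)) := by
  obtain ⟨M, ω, hM, hω, hb⟩ := hT.exists_growth_bound
  have hB0 : 0 ≤ B := (norm_nonneg _).trans (hB 0 0)
  set l := ω + 2 * M * L + 1 with hl
  have hML : 0 ≤ M * L := by positivity
  have hlω : ω < l := by linarith
  have hl0 : 0 < l := by linarith
  let E := BoundedContinuousFunction ℝ X
  let w : E → ℝ → X := fun y s => Real.exp (l * s) • y s
  have hw : ∀ y, Continuous (w y) := fun y => by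
    have := y.continuous
    simp only [w]
    fun_prop
  let P : E → ℝ → X := fun y t => Real.exp (-(l * max t 0)) • (T (max t 0) x +
    ∫ s in (0 : ℝ)..(max t 0), T (max (max t 0 - s) 0) (G s (w y s)))
  have hker : ∀ t, 0 ≤ t → ∀ h : ℝ → X, ∫ s in (0 : ℝ)..t, T (max (t - s) 0) (h s) =
      ∫ s in (0 : ℝ)..t, T (t - s) (h s) := fun t ht h =>
    intervalIntegral.integral_congr fun s hs => by
      rw [uIcc_of_le ht] at hs
      simp only [max_eq_left (sub_nonneg.2 hs.2)]
  have hPc : ∀ y, Continuous (P y) := by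
    intro y
    have hx : Continuous fun t : ℝ => T (max t 0) x :=
      (hT.2.2 x).comp_continuous (by fun_prop) fun t => le_max_right t 0
    have hc := (hT.continuous_convolution (hG _ (hw y)) fun s => hB s _).comp
      (by fun_prop : Continuous fun t : ℝ => max t 0)
    exact (by fun_prop : Continuous fun t : ℝ => Real.exp (-(l * max t 0))).smul (hx.add hc)
  have hPb : ∀ y t, ‖P y t‖ ≤ M * ‖x‖ + M * B / (l - ω) := by
    intro y t
    have ht : 0 ≤ max t 0 := le_max_right t 0
    simp only [P]
    generalize max t 0 = t at ht
    rw [hker t ht, norm_smul, Real.norm_of_nonneg (Real.exp_pos _).le]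
    have h1 : ‖T t x‖ ≤ M * Real.exp (l * t) * ‖x‖ :=
      (T t).le_of_opNorm_le ((hb t ht).trans (by gcongr)) x
    have h2 := norm_convolution_le (h := fun s => G s (w y s)) (by linarith) hb hB0 hlω ht
      fun s hs => (hB s _).trans
        (le_mul_of_one_le_right hB0 (Real.one_le_exp (mul_nonneg hl0.le hs.1)))
    calc _ ≤ Real.exp (-(l * t)) *
          (M * Real.exp (l * t) * ‖x‖ + M * B / (l - ω) * Real.exp (l * t)) := by
          gcongr
          exact (norm_add_le _ _).trans (add_le_add h1 h2)
      _ = (Real.exp (-(l * t)) * Real.exp (l * t)) * (M * ‖x‖ + M * B / (l - ω)) := by ring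
      _ = _ := by rw [← Real.exp_add]; simp
  let Φ : E → E := fun y => BoundedContinuousFunction.ofNormedAddCommGroup (P y) (hPc y) _ (hPb y)
  have hΦ : ContractingWith (1 / 2) Φ := by
    refine ⟨by norm_num [← NNReal.coe_lt_coe], LipschitzWith.of_dist_le_mul fun y y' => ?_⟩
    rw [BoundedContinuousFunction.dist_le (by positivity)]
    intro t
    have ht : 0 ≤ max t 0 := le_max_right t 0
    change dist (P y t) (P y' t) ≤ _
    simp only [P]
    generalize max t 0 = t at ht
    have hi : ∀ y, IntervalIntegrable (fun s => T (t - s) (G s (w y s))) volume 0 t := fun y =>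
      hT.intervalIntegrable_kernel (hG _ (hw y)) ht fun s _ => hB s _
    rw [hker t ht, hker t ht, dist_eq_norm, ← smul_sub, add_sub_add_left_eq_sub,
      ← intervalIntegral.integral_sub (hi y) (hi y'), norm_smul,
      Real.norm_of_nonneg (Real.exp_pos _).le]
    simp only [← map_sub]
    have h2 := norm_convolution_le (h := fun s => G s (w y s) - G s (w y' s)) (by linarith) hb
      (C := L * dist y y') (by positivity) hlω ht fun s hs => by
        refine (hL s _ _).trans ?_
        rw [mul_assoc]
        refine mul_le_mul_of_nonneg_left ?_ hL0
        simp only [w]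
        rw [← smul_sub, norm_smul, Real.norm_of_nonneg (Real.exp_pos _).le, mul_comm,
          ← dist_eq_norm]
        exact mul_le_mul_of_nonneg_right (BoundedContinuousFunction.dist_coe_le_dist s)
          (Real.exp_pos _).le
    calc _ ≤ Real.exp (-(l * t)) * (M * (L * dist y y') / (l - ω) * Real.exp (l * t)) := by
          gcongr
      _ = (Real.exp (-(l * t)) * Real.exp (l * t)) * (M * L / (l - ω) * dist y y') := by ring
      _ = M * L / (l - ω) * dist y y' := by rw [← Real.exp_add]; simp
      _ ≤ _ := by
          refine mul_le_mul_of_nonneg_right ?_ dist_nonneg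
          rw [div_le_iff₀ (by linarith)]
          push_cast
          linarith
  set y := ContractingWith.fixedPoint Φ hΦ
  have hy : Φ y = y := hΦ.fixedPoint_isFixedPt
  refine ⟨w y, hw y, fun t ht => ?_⟩
  have h1 : y t = P y t := by
    conv_lhs => rw [← hy]
    rfl
  simp only [P, max_eq_left ht] at h1
  rw [hker t ht] at h1
  change Real.exp (l * t) • y t = _
  rw [h1, smul_smul, ← Real.exp_add]
  simp

theorem mild_solution_unique (hT : IsC0Semigroup T) {x : X} {y₁ y₂ h₁ h₂ : ℝ → X}
    {a L C₁ C₂ : ℝ} (hy₁ : Continuous y₁) (hy₂ : Continuous y₂)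
    (hh₁ : AEStronglyMeasurable h₁ volume) (hh₂ : AEStronglyMeasurable h₂ volume)
    (hC₁ : ∀ s ∈ Icc 0 a, ‖h₁ s‖ ≤ C₁) (hC₂ : ∀ s ∈ Icc 0 a, ‖h₂ s‖ ≤ C₂)
    (h1 : ∀ t ∈ Icc 0 a, y₁ t = T t x + ∫ s in (0 : ℝ)..t, T (t - s) (h₁ s))
    (h2 : ∀ t ∈ Icc 0 a, y₂ t = T t x + ∫ s in (0 : ℝ)..t, T (t - s) (h₂ s))
    (hL : ∀ s ∈ Icc 0 a, ‖h₁ s - h₂ s‖ ≤ L * ‖y₁ s - y₂ s‖) :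
    ∀ t ∈ Icc 0 a, y₁ t = y₂ t := by
  obtain ⟨M, ω, hM, hω, hb⟩ := hT.exists_growth_bound
  set w : ℝ → ℝ := fun s => ‖y₁ s - y₂ s‖
  have hw : Continuous w := (hy₁.sub hy₂).norm
  set K := M * Real.exp (ω * a) * L
  have hwle : ∀ t ∈ Icc 0 a, w t ≤ K * ∫ s in (0 : ℝ)..t, w s := by
    intro t ht
    have hi₁ := hT.intervalIntegrable_kernel hh₁ ht.1 fun s hs => hC₁ s ⟨hs.1, hs.2.trans ht.2⟩
    have hi₂ := hT.intervalIntegrable_kernel hh₂ ht.1 fun s hs => hC₂ s ⟨hs.1, hs.2.trans ht.2⟩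
    simp only [w]
    rw [h1 t ht, h2 t ht, add_sub_add_left_eq_sub, ← intervalIntegral.integral_sub hi₁ hi₂,
      ← intervalIntegral.integral_const_mul]
    refine intervalIntegral.norm_integral_le_of_norm_le ht.1 (Eventually.of_forall fun s hs => ?_)
      ((hw.const_mul K).intervalIntegrable _ _)
    have hsa : s ∈ Icc 0 a := ⟨hs.1.le, hs.2.trans ht.2⟩
    have hTs : ‖T (t - s)‖ ≤ M * Real.exp (ω * a) := by
      refine (hb _ (sub_nonneg.2 hs.2)).trans ?_
      gcongr
      linarith [ht.2, hs.1]
    rw [← map_sub]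
    exact ((T (t - s)).le_of_opNorm_le_of_le hTs (hL s hsa)).trans_eq (by simp only [K]; ring)
  have hW0 : ∀ t, 0 ≤ t → 0 ≤ ∫ s in (0 : ℝ)..t, w s := fun t ht =>
    intervalIntegral.integral_nonneg ht fun s _ => norm_nonneg _
  have hW : ∀ t : ℝ, HasDerivAt (fun t => ∫ s in (0 : ℝ)..t, w s) (w t) t := fun t =>
    intervalIntegral.integral_hasDerivAt_right (hw.intervalIntegrable _ _)
      (hw.stronglyMeasurableAtFilter _ _) hw.continuousAt
  intro t ht
  have hg := norm_le_gronwallBound_of_norm_deriv_right_le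
    (δ := 0) (K := K) (ε := 0) (a := 0) (b := a)
    (fun t _ => (hW t).continuousAt.continuousWithinAt) (fun t _ => (hW t).hasDerivWithinAt)
    (by simp) (fun s hs => by
      rw [Real.norm_of_nonneg (norm_nonneg _), Real.norm_of_nonneg (hW0 s hs.1), add_zero]
      exact hwle s ⟨hs.1, hs.2.le⟩) t ht
  rw [gronwallBound_ε0_δ0, Real.norm_of_nonneg (hW0 t ht.1)] at hg
  have hz : ∫ s in (0 : ℝ)..t, w s = 0 := le_antisymm hg (hW0 t ht.1)
  have := hwle t ht
  rw [hz, mul_zero] at this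
  exact sub_eq_zero.1 (norm_le_zero_iff.1 this)

end IsC0Semigroup

end MildSolutions

section ComparisonFunctions

theorem ClassK.nonneg {γ : ℝ → ℝ} (hγ : ClassK γ) {r : ℝ} (hr : 0 ≤ r) : 0 ≤ γ r :=
  hγ.2.2 ▸ hγ.2.1.monotoneOn self_mem_Ici hr hr

theorem exists_classKL_ge_iInf {b : ℕ → ℝ → ℝ → ℝ}
    (hcont : ∀ n, ContinuousOn (fun p : ℝ × ℝ => b n p.1 p.2) (Ici 0 ×ˢ Ici 0))
    (hnonneg : ∀ n r t, 0 ≤ r → 0 ≤ t → 0 ≤ b n r t)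
    (hmono : ∀ n r r' t, 0 ≤ r → r ≤ r' → 0 ≤ t → b n r t ≤ b n r' t)
    (hanti : ∀ n r t t', 0 ≤ r → 0 ≤ t → t ≤ t' → b n r t' ≤ b n r t)
    (hzero : ∀ t, 0 ≤ t → b 0 0 t = 0)
    (hlim : ∀ r ε, 0 < r → 0 < ε → ∃ n, ∀ᶠ t in atTop, b n r t < ε) :
    ∃ β : ℝ → ℝ → ℝ, ClassKL β ∧
      ∀ r t y, 0 ≤ r → 0 ≤ t → (∀ n, y ≤ b n r t) → y ≤ β r t := by
  -- the penalty `n * (r * exp (-t))` makes the infimum locally finite, hence continuous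
  set c : ℕ → ℝ → ℝ → ℝ := fun n r t => b n r t + n * (r * Real.exp (-t)) with hc
  have hc0 : ∀ n r t, 0 ≤ r → 0 ≤ t → 0 ≤ c n r t := fun n r t hr ht =>
    add_nonneg (hnonneg n r t hr ht) (by positivity)
  have hbdd : ∀ r t, 0 ≤ r → 0 ≤ t → BddBelow (range fun n => c n r t) := fun r t hr ht =>
    ⟨0, by rintro _ ⟨n, rfl⟩; exact hc0 n r t hr ht⟩
  set m : ℝ → ℝ → ℝ := fun r t => ⨅ n, c n r t with hm
  have hm0 : ∀ r t, 0 ≤ r → 0 ≤ t → 0 ≤ m r t := fun r t hr ht => le_ciInf fun n => hc0 n r t hr ht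
  have hmle : ∀ n r t, 0 ≤ r → 0 ≤ t → m r t ≤ c n r t := fun n r t hr ht =>
    ciInf_le (hbdd r t hr ht) n
  have hmz : ∀ t, 0 ≤ t → m 0 t = 0 := fun t ht =>
    le_antisymm ((hmle 0 0 t le_rfl ht).trans_eq (by simp [hc, hzero t ht])) (hm0 0 t le_rfl ht)
  have hmr : ∀ r r' t, 0 ≤ r → r ≤ r' → 0 ≤ t → m r t ≤ m r' t := fun r r' t hr hrr ht =>
    ciInf_mono (hbdd r t hr ht) fun n => by
      simp only [hc]
      gcongr
      exact hmono n r r' t hr hrr ht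
  have hmt : ∀ r t t', 0 ≤ r → 0 ≤ t → t ≤ t' → m r t' ≤ m r t := fun r t t' hr ht htt =>
    ciInf_mono (hbdd r t' hr (ht.trans htt)) fun n => by
      simp only [hc]
      gcongr
      exact hanti n r t t' hr ht htt
  have hcc : ∀ n, ContinuousOn (fun p : ℝ × ℝ => c n p.1 p.2) (Ici 0 ×ˢ Ici 0) := fun n =>
    (hcont n).add (by fun_prop)
  have hmc : ContinuousOn (fun p : ℝ × ℝ => m p.1 p.2) (Ici 0 ×ˢ Ici 0) := by
    rintro ⟨r₀, t₀⟩ ⟨hr₀, ht₀⟩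
    simp only [mem_Ici] at hr₀ ht₀
    refine tendsto_order.2 ⟨fun y hy => ?_, fun y hy => ?_⟩
    · rcases hr₀.eq_or_lt with rfl | hpos
      · simp only [hmz t₀ ht₀] at hy
        filter_upwards [self_mem_nhdsWithin] with p hp
        exact hy.trans_le (hm0 _ _ hp.1 hp.2)
      · obtain ⟨y', hyy', hy'⟩ := exists_between hy
        obtain ⟨N, hN⟩ := exists_nat_gt (y' / (r₀ * Real.exp (-t₀)))
        rw [div_lt_iff₀ (by positivity)] at hN
        have hbig : ∀ᶠ p : ℝ × ℝ in 𝓝[Ici 0 ×ˢ Ici 0] (r₀, t₀),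
            y' < N * (p.1 * Real.exp (-p.2)) := by
          have : Continuous fun p : ℝ × ℝ => (N : ℝ) * (p.1 * Real.exp (-p.2)) := by fun_prop
          exact ((this.tendsto (r₀, t₀)).eventually_const_lt hN).filter_mono nhdsWithin_le_nhds
        have hsmall : ∀ᶠ p : ℝ × ℝ in 𝓝[Ici 0 ×ˢ Ici 0] (r₀, t₀),
            ∀ n ∈ Finset.range N, y' < c n p.1 p.2 :=
          (Finset.eventually_all _).2 fun n _ =>
            (hcc n (r₀, t₀) ⟨hr₀, ht₀⟩).eventually_const_lt (hy'.trans_le (hmle n r₀ t₀ hr₀ ht₀))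
        filter_upwards [hbig, hsmall, self_mem_nhdsWithin] with p h1 h2 hp
        refine hyy'.trans_le (le_ciInf fun n => ?_)
        rcases lt_or_ge n N with hn | hn
        · exact (h2 n (Finset.mem_range.2 hn)).le
        · have hp1 : (0 : ℝ) ≤ p.1 := hp.1
          calc y' ≤ N * (p.1 * Real.exp (-p.2)) := h1.le
            _ ≤ n * (p.1 * Real.exp (-p.2)) := by gcongr
            _ ≤ c n p.1 p.2 := le_add_of_nonneg_left (hnonneg n _ _ hp.1 hp.2)
    · obtain ⟨n, hn⟩ := exists_lt_of_ciInf_lt hy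
      filter_upwards [(hcc n (r₀, t₀) ⟨hr₀, ht₀⟩).eventually_lt_const hn, self_mem_nhdsWithin]
        with p h1 hp
      exact (hmle n _ _ hp.1 hp.2).trans_lt h1
  have hexp : ∀ r : ℝ, Tendsto (fun t : ℝ => r * Real.exp (-t)) atTop (𝓝 0) := fun r => by
    simpa using (Real.tendsto_exp_neg_atTop_nhds_zero).const_mul r
  refine ⟨fun r t => r * Real.exp (-t) + m r t,
    ⟨?_, fun t ht => ⟨?_, ?_, ?_⟩, fun r hr => ⟨?_, ?_⟩⟩,
    fun r t y hr ht hy => ?_⟩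
  · exact ContinuousOn.add (by fun_prop) hmc
  · exact ContinuousOn.add (by fun_prop)
      (hmc.comp (f := fun r => (r, t)) (by fun_prop) fun r hr => ⟨hr, ht⟩)
  · intro r hr r' hr' hrr
    exact add_lt_add_of_lt_of_le (mul_lt_mul_of_pos_right hrr (Real.exp_pos _))
      (hmr r r' t hr hrr.le ht)
  · simp [hmz t ht]
  · intro t ht t' ht' htt
    exact add_lt_add_of_lt_of_le
      (mul_lt_mul_of_pos_left (Real.exp_lt_exp.2 (neg_lt_neg htt)) hr) (hmt r t t' hr.le ht htt.le)
  · have hml : Tendsto (m r) atTop (𝓝 0) := by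
      refine tendsto_order.2 ⟨fun y hy => ?_, fun y hy => ?_⟩
      · filter_upwards [eventually_ge_atTop 0] with t ht
        exact hy.trans_le (hm0 r t hr.le ht)
      · obtain ⟨n, hn⟩ := hlim r (y / 2) hr (half_pos hy)
        have h2 := ((hexp r).const_mul (n : ℝ)).eventually_lt_const
          (show (n : ℝ) * 0 < y / 2 by simpa using hy)
        filter_upwards [hn, h2, eventually_ge_atTop 0] with t h1 h2 ht
        refine (hmle n r t hr.le ht).trans_lt ?_
        simp only [hc]
        linarith
    simpa using (hexp r).add hml
  · refine (le_ciInf fun n => ?_ : y ≤ m r t).trans (le_add_of_nonneg_left (by positivity))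
    exact (hy n).trans (le_add_of_nonneg_right (by positivity))

/-- Iterating a decay estimate `g` over successive halves of a time interval. -/
noncomputable def halvingIterate (g : ℝ → ℝ → ℝ) : ℕ → ℝ → ℝ → ℝ
  | 0 => g
  | n + 1 => fun r t => g (halvingIterate g n r (t / 2)) (t / 2)

theorem exists_classKL_ge_halvingIterate {β : ℝ → ℝ → ℝ} (hβ : ClassKL β) :
    ∃ β' : ℝ → ℝ → ℝ, ClassKL β' ∧ ∀ r t y, 0 ≤ r → 0 ≤ t →
      (∀ n, y ≤ halvingIterate (fun r t => β r t + r / 4) n r t) → y ≤ β' r t := by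
  obtain ⟨hc, hK, hL⟩ := hβ
  have hβ0 : ∀ r t, 0 ≤ r → 0 ≤ t → 0 ≤ β r t := fun r t hr ht => (hK t ht).nonneg hr
  have hβr : ∀ r r' t, 0 ≤ r → r ≤ r' → 0 ≤ t → β r t ≤ β r' t := fun r r' t hr hrr ht =>
    (hK t ht).2.1.monotoneOn hr (hr.trans hrr) hrr
  have hβt : ∀ r t t', 0 ≤ r → 0 ≤ t → t ≤ t' → β r t' ≤ β r t := by
    intro r t t' hr ht htt
    rcases hr.eq_or_lt with rfl | hr
    · exact ((hK t' (ht.trans htt)).2.2.trans (hK t ht).2.2.symm).le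
    · exact (hL r hr).1.antitoneOn ht (ht.trans htt) htt
  set g : ℝ → ℝ → ℝ := fun r t => β r t + r / 4 with hg
  have hgc : ContinuousOn (fun p : ℝ × ℝ => g p.1 p.2) (Ici 0 ×ˢ Ici 0) := hc.add (by fun_prop)
  have h0 : ∀ n r t, 0 ≤ r → 0 ≤ t → 0 ≤ halvingIterate g n r t := by
    intro n
    induction n with
    | zero => exact fun r t hr ht => add_nonneg (hβ0 r t hr ht) (by positivity)
    | succ n ih =>
      intro r t hr ht
      have h := ih r (t / 2) hr (by positivity)
      exact add_nonneg (hβ0 _ _ h (by positivity)) (by positivity)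
  have hgr : ∀ r r' t, 0 ≤ r → r ≤ r' → 0 ≤ t → g r t ≤ g r' t := fun r r' t hr hrr ht =>
    add_le_add (hβr r r' t hr hrr ht) (by linarith)
  have hgt : ∀ r t t', 0 ≤ r → 0 ≤ t → t ≤ t' → g r t' ≤ g r t := fun r t t' hr ht htt =>
    add_le_add_left (hβt r t t' hr ht htt) _
  have ha : ∀ n r t t', 0 ≤ r → 0 ≤ t → t ≤ t' →
      halvingIterate g n r t' ≤ halvingIterate g n r t := by
    intro n
    induction n with
    | zero => exact hgt
    | succ n ih =>
      intro r t t' hr ht htt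
      have ht' := ht.trans htt
      exact (hgr _ _ _ (h0 n r _ hr (by positivity))
        (ih r (t / 2) (t' / 2) hr (by positivity) (by linarith)) (by positivity)).trans
        (hgt _ _ _ (h0 n r _ hr (by positivity)) (by positivity) (by linarith))
  refine exists_classKL_ge_iInf ?_ h0 ?_ ha ?_ ?_
  · intro n
    induction n with
    | zero => exact hgc
    | succ n ih =>
      have hm : MapsTo (fun p : ℝ × ℝ => (p.1, p.2 / 2)) (Ici 0 ×ˢ Ici 0) (Ici 0 ×ˢ Ici 0) :=
        fun p hp => ⟨hp.1, div_nonneg (mem_Ici.1 hp.2) zero_le_two⟩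
      exact hgc.comp (f := fun p : ℝ × ℝ => (halvingIterate g n p.1 (p.2 / 2), p.2 / 2))
        ((ih.comp (f := fun p : ℝ × ℝ => (p.1, p.2 / 2)) (by fun_prop) hm).prodMk (by fun_prop))
        fun p hp => ⟨h0 n _ _ (hm hp).1 (hm hp).2, (hm hp).2⟩
  · intro n
    induction n with
    | zero => exact hgr
    | succ n ih =>
      intro r r' t hr hrr ht
      exact hgr _ _ _ (h0 n r _ hr (by positivity)) (ih r r' _ hr hrr (by positivity))
        (by positivity)
  · intro t ht
    simpa [halvingIterate, hg] using (hK t ht).2.2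
  · intro r ε hr hε
    have hhalf : Tendsto (fun t : ℝ => t / 2) atTop atTop :=
      tendsto_id.atTop_div_const two_pos
    have key : ∀ n : ℕ, ∀ᶠ t in atTop, halvingIterate g n r t < r / 2 ^ n := by
      intro n
      induction n with
      | zero =>
        filter_upwards [(hL r hr).2.eventually_lt_const (show 0 < r / 2 by positivity)] with t ht
        simp only [halvingIterate, hg]
        linarith
      | succ n ih =>
        set B := halvingIterate g n r 0 + 1
        have hB : 0 < B := by linarith [h0 n r 0 hr.le le_rfl]
        have h1 := hhalf.eventually ((hL B hB).2.eventually_lt_const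
          (show 0 < r / 2 ^ n / 4 by positivity))
        filter_upwards [h1, hhalf.eventually ih, eventually_ge_atTop 0] with t h1 h2 ht
        have ht2 : 0 ≤ t / 2 := by positivity
        have h3 := hβr (halvingIterate g n r (t / 2)) B (t / 2) (h0 n r _ hr.le ht2)
          (by linarith [ha n r 0 (t / 2) hr.le le_rfl ht2]) ht2
        simp only [halvingIterate]
        rw [pow_succ, ← div_div]
        simp only [hg] at *
        linarith
    obtain ⟨n, hn⟩ := exists_pow_lt_of_lt_one (show 0 < ε / r by positivity)
      (show (1 / 2 : ℝ) < 1 by norm_num)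
    refine ⟨n, (key n).mono fun t ht => ht.trans ?_⟩
    rw [lt_div_iff₀ hr] at hn
    calc r / 2 ^ n = (1 / 2) ^ n * r := by rw [one_div_pow]; ring
      _ < ε := hn

/-- A `1`-Lipschitz gain of class `K∞` dominated by the inverse of `ω`. -/
theorem exists_classKinf_lipschitz_le_inverse {ω : ℝ → ℝ} (hc : ContinuousOn ω (Ici 0))
    (hm : MonotoneOn ω (Ici 0)) (h0 : ω 0 = 0) :
    ∃ η : ℝ → ℝ, ClassKinf η ∧ (∀ s s', 0 ≤ s → 0 ≤ s' → |η s - η s'| ≤ |s - s'|) ∧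
      ∀ s, 0 ≤ s → ω (η s) ≤ s := by
  have hex : ∀ s : ℝ, ∃ e : ℝ, 0 ≤ s → 0 ≤ e ∧ ω e + e = s := by
    intro s
    by_cases hs : 0 ≤ s
    · have hωs : 0 ≤ ω s := h0 ▸ hm self_mem_Ici hs hs
      obtain ⟨e, he, hes⟩ := intermediate_value_Icc hs
        ((hc.add continuousOn_id).mono (Icc_subset_Ici_self : Icc 0 s ⊆ Ici 0))
        (show s ∈ Icc (ω 0 + id 0) (ω s + id s) by simp [h0, hs, hωs])
      exact ⟨e, fun _ => ⟨he.1, hes⟩⟩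
    · exact ⟨0, fun h => absurd h hs⟩
  choose η hη using hex
  have hle : ∀ s s', 0 ≤ s → s ≤ s' → 0 ≤ η s' - η s ∧ η s' - η s ≤ s' - s := by
    intro s s' hs hss
    obtain ⟨h1, h2⟩ := hη s hs
    obtain ⟨h3, h4⟩ := hη s' (hs.trans hss)
    rcases le_total (η s) (η s') with h | h
    · exact ⟨by linarith, by linarith [hm h1 h3 h]⟩
    · have := hm h3 h1 h
      exact ⟨by linarith, by linarith⟩
  have hlip : ∀ s s', 0 ≤ s → 0 ≤ s' → |η s - η s'| ≤ |s - s'| := by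
    intro s s' hs hs'
    rcases le_total s s' with h | h
    · have := hle s s' hs h
      rw [abs_sub_comm, abs_sub_comm s, abs_of_nonneg this.1, abs_of_nonneg (sub_nonneg.2 h)]
      exact this.2
    · have := hle s' s hs' h
      rw [abs_of_nonneg this.1, abs_of_nonneg (sub_nonneg.2 h)]
      exact this.2
  refine ⟨η, ⟨⟨?_, ?_, ?_⟩, fun M => ?_⟩, hlip, fun s hs => ?_⟩
  · refine (LipschitzOnWith.of_dist_le_mul (K := 1) fun s hs s' hs' => ?_).continuousOn
    simpa [Real.dist_eq] using hlip s s' hs hs'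
  · intro s hs s' hs' hss
    refine lt_of_le_of_ne (sub_nonneg.1 (hle s s' hs hss.le).1) fun h => hss.ne ?_
    rw [← (hη s hs).2, ← (hη s' hs').2, h]
  · obtain ⟨h1, h2⟩ := hη 0 le_rfl
    have := hm self_mem_Ici h1 h1
    linarith
  · set N := |M| + 1
    have hN : 0 < N := by positivity
    have hωN : 0 ≤ ω N := h0 ▸ hm self_mem_Ici hN.le hN.le
    refine ⟨ω N + N, by linarith, ?_⟩
    obtain ⟨h1, h2⟩ := hη (ω N + N) (by linarith)
    by_contra! h
    have h3 : η (ω N + N) < N := h.trans_lt (by linarith [le_abs_self M])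
    linarith [hm h1 hN.le h3.le]
  · obtain ⟨h1, h2⟩ := hη s hs
    linarith

end ComparisonFunctions

section RadialRetraction

variable {X : Type*} [NormedAddCommGroup X] [NormedSpace ℝ X]

/-- The radial retraction onto the closed ball of radius `R`. -/
noncomputable def radialRetraction (R : ℝ) (x : X) : X := (R / max R ‖x‖) • x

theorem norm_radialRetraction_le {R : ℝ} (hR : 0 < R) (x : X) : ‖radialRetraction R x‖ ≤ R := by
  have hm : 0 < max R ‖x‖ := lt_max_of_lt_left hR
  rw [radialRetraction, norm_smul, Real.norm_of_nonneg (by positivity), div_mul_eq_mul_div,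
    div_le_iff₀ hm]
  exact mul_le_mul_of_nonneg_left (le_max_right _ _) hR.le

theorem radialRetraction_of_norm_le {R : ℝ} (hR : 0 < R) {x : X} (hx : ‖x‖ ≤ R) :
    radialRetraction R x = x := by
  rw [radialRetraction, max_eq_left hx, div_self hR.ne', one_smul]

theorem norm_radialRetraction_sub_le {R : ℝ} (hR : 0 < R) (x y : X) :
    ‖radialRetraction R x - radialRetraction R y‖ ≤ 2 * ‖x - y‖ := by
  have ha : 0 < max R ‖x‖ := lt_max_of_lt_left hR
  have hb : 0 < max R ‖y‖ := lt_max_of_lt_left hR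
  have hab : |max R ‖y‖ - max R ‖x‖| ≤ ‖x - y‖ := by
    rw [abs_sub_comm, max_comm R, max_comm R]
    exact (abs_max_sub_max_le_abs _ _ _).trans (abs_norm_sub_norm_le x y)
  have h1 : R / max R ‖x‖ ≤ 1 := (div_le_one ha).2 (le_max_left _ _)
  have hsplit : radialRetraction R x - radialRetraction R y =
      (R / max R ‖x‖) • (x - y) + (R / max R ‖x‖ - R / max R ‖y‖) • y := by
    simp only [radialRetraction]
    module
  have h2 : ‖(R / max R ‖x‖) • (x - y)‖ ≤ ‖x - y‖ := by
    rw [norm_smul, Real.norm_of_nonneg (by positivity)]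
    exact mul_le_of_le_one_left (norm_nonneg _) h1
  have h3 : ‖(R / max R ‖x‖ - R / max R ‖y‖) • y‖ ≤ ‖x - y‖ := by
    have heq : R / max R ‖x‖ - R / max R ‖y‖ =
        R / max R ‖x‖ * ((max R ‖y‖ - max R ‖x‖) / max R ‖y‖) := by
      field_simp
    rw [norm_smul, heq, norm_mul, norm_div (max R ‖y‖ - _),
      Real.norm_of_nonneg (show 0 ≤ R / max R ‖x‖ by positivity), Real.norm_of_nonneg hb.le,
      Real.norm_eq_abs]
    calc R / max R ‖x‖ * (|max R ‖y‖ - max R ‖x‖| / max R ‖y‖) * ‖y‖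
        = R / max R ‖x‖ * (|max R ‖y‖ - max R ‖x‖| * (‖y‖ / max R ‖y‖)) := by ring
      _ ≤ 1 * (‖x - y‖ * 1) := by
          gcongr
          exact (div_le_one hb).2 (le_max_right _ _)
      _ = ‖x - y‖ := by ring
  rw [hsplit, two_mul]
  exact (norm_add_le _ _).trans (add_le_add h2 h3)

theorem continuous_radialRetraction {R : ℝ} (hR : 0 < R) :
    Continuous (radialRetraction R : X → X) :=
  (LipschitzWith.of_dist_le_mul (K := 2) fun x y => by
    simpa [dist_eq_norm] using norm_radialRetraction_sub_le hR x y).continuous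

end RadialRetraction

section ClosedLoop

theorem lt_of_forall_le_imp_lt {g : ℝ → ℝ} {a : ℝ} (hg : Continuous g) (h0 : g 0 < a)
    (h : ∀ t, 0 ≤ t → (∀ s ∈ Icc 0 t, g s ≤ a) → g t < a) {t : ℝ} (ht : 0 ≤ t) : g t < a := by
  by_contra! hat
  have hA : IsCompact (Icc 0 t ∩ g ⁻¹' Ici a) :=
    isCompact_Icc.inter_right (isClosed_Ici.preimage hg)
  obtain ⟨b, ⟨hb, hab⟩, hleast⟩ := hA.exists_isLeast ⟨t, ⟨ht, le_rfl⟩, hat⟩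
  obtain ⟨s, hs, hsa⟩ := intermediate_value_Icc hb.1 hg.continuousOn ⟨h0.le, hab⟩
  have hbs : b ≤ s := hleast ⟨⟨hs.1, hs.2.trans hb.2⟩, hsa.ge⟩
  obtain rfl : s = b := le_antisymm hs.2 hbs
  refine (h s hb.1 fun σ hσ => ?_).ne hsa
  by_contra! hlt
  obtain rfl : s = σ := le_antisymm (hleast ⟨⟨hσ.1, hσ.2.trans hb.2⟩, hlt.le⟩) hσ.2
  exact hlt.ne' hsa

variable {X : Type*} [NormedAddCommGroup X] [NormedSpace ℝ X]

theorem IsMildSolution.comp_max {U : Type*} {T : ℝ → X →L[ℝ] X} {F : X → U → X} {x : X}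
    {d : ℝ → U} {y : ℝ → X}
    (hy : IsMildSolution T F x d y) :
    Continuous (fun t => y (max t 0)) ∧ IsMildSolution T F x d fun t => y (max t 0) := by
  have hc : Continuous fun t => y (max t 0) :=
    hy.2.1.comp_continuous (by fun_prop) fun t => le_max_right t 0
  refine ⟨hc, by simpa using hy.1, hc.continuousOn, fun t ht => ?_⟩
  simp only [max_eq_left ht]
  rw [hy.2.2 t ht]
  congr 1
  refine intervalIntegral.integral_congr fun s hs => ?_
  rw [uIcc_of_le ht] at hs
  simp only [max_eq_left hs.1]

variable {U : Type*} [NormedAddCommGroup U]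

theorem PiecewiseContinuous.indicator_Icc {u : ℝ → U} (hu : PiecewiseContinuous u) (a b : ℝ) :
    PiecewiseContinuous ((Icc a b).indicator u) := by
  classical
  intro c e
  obtain ⟨S, hS⟩ := hu c e
  refine ⟨S ∪ {a, b}, fun t ht htS => ?_⟩
  simp only [Finset.mem_union, Finset.mem_insert, Finset.mem_singleton, not_or] at htS
  by_cases hab : t ∈ Icc a b
  · have hmem : Ioo a b ∈ 𝓝 t :=
      Ioo_mem_nhds (lt_of_le_of_ne hab.1 (Ne.symm htS.2.1)) (lt_of_le_of_ne hab.2 htS.2.2)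
    refine (hS t ht htS.1).congr ?_
    filter_upwards [hmem] with s hs
    rw [indicator_of_mem (Ioo_subset_Icc_self hs)]
  · refine (continuousAt_const (y := (0 : U))).congr ?_
    filter_upwards [isClosed_Icc.isOpen_compl.mem_nhds hab] with s hs
    rw [indicator_of_notMem hs]

theorem PiecewiseContinuous.comp_const_add {u : ℝ → U} (hu : PiecewiseContinuous u) (a : ℝ) :
    PiecewiseContinuous fun s => u (a + s) := by
  classical
  intro b c
  obtain ⟨S, hS⟩ := hu (a + b) (a + c)
  refine ⟨S.image fun s => s - a, fun t ht htS => ?_⟩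
  refine (hS (a + t) ⟨by linarith [ht.1], by linarith [ht.2]⟩ fun h => htS ?_).comp
    (f := fun s => a + s) (by fun_prop)
  exact Finset.mem_image.2 ⟨a + t, h, by ring⟩

variable [CompleteSpace X] {T : ℝ → X →L[ℝ] X} {F : X → U → X}

theorem IsMildSolution.shift (hT : IsC0Semigroup T) (hFc : Continuous fun p : X × U => F p.1 p.2)
    (hFb : ∀ C, ∃ B, ∀ x v, ‖x‖ ≤ C → ‖v‖ ≤ 1 → ‖F x v‖ ≤ B) {x : X} {d : ℝ → U} {y : ℝ → X}
    (hd : AdmissibleDisturbance d) (hyc : Continuous y) (hy : IsMildSolution T F x d y) {a : ℝ}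
    (ha : 0 ≤ a) : IsMildSolution T F (y a) (fun s => d (a + s)) fun s => y (a + s) := by
  refine ⟨by simp, by fun_prop, fun t ht => ?_⟩
  change y (a + t) = T t (y a) + ∫ s in (0 : ℝ)..t, T (t - s) (F (y (a + s)) (d (a + s)))
  obtain ⟨C, hC⟩ := (isCompact_Icc (a := 0) (b := a + t)).exists_bound_of_continuousOn
    hyc.continuousOn
  obtain ⟨B, hB⟩ := hFb C
  have hm : AEStronglyMeasurable (fun s => F (y s) (d s)) volume :=
    hFc.comp_aestronglyMeasurable (hyc.aestronglyMeasurable.prodMk hd.1.aestronglyMeasurable)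
  rw [hy.2.2 (a + t) (add_nonneg ha ht), hT.convolution_add hm ha ht
    fun s hs => hB _ _ (hC s hs) (hd.2 s hs.1), hy.2.2 a ha, map_add, add_assoc, add_comm a t,
    hT.2.1 t ht a ha, ContinuousLinearMap.comp_apply]

theorem exists_mild_solution_until_exit (hT : IsC0Semigroup T)
    (hFc : Continuous fun p : X × U => F p.1 p.2)
    (hFb : ∀ C, ∃ B, ∀ x v, ‖x‖ ≤ C → ‖v‖ ≤ 1 → ‖F x v‖ ≤ B)
    (hFL : ∀ C, 0 < C → ∃ L, 0 < L ∧ ∀ x y v, ‖x‖ ≤ C → ‖y‖ ≤ C → ‖v‖ ≤ 1 →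
      ‖F x v - F y v‖ ≤ L * ‖x - y‖)
    {d : ℝ → U} (hd : AdmissibleDisturbance d) (x : X) {R : ℝ} (hR : 0 < R) :
    ∃ y : ℝ → X, Continuous y ∧ y 0 = x ∧ ∀ t, 0 ≤ t → (∀ s ∈ Icc 0 t, ‖y s‖ ≤ R) →
      y t = T t x + ∫ s in (0 : ℝ)..t, T (t - s) (F (y s) (d s)) := by
  obtain ⟨B, hB⟩ := hFb R
  obtain ⟨L, hL0, hL⟩ := hFL R hR
  set d' := (Ici (0 : ℝ)).indicator d
  have hd' : ∀ s, ‖d' s‖ ≤ 1 := fun s => by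
    by_cases hs : s ∈ Ici (0 : ℝ)
    · simpa [d', indicator_of_mem hs] using hd.2 s hs
    · simp [d', indicator_of_notMem hs]
  have hdm : AEStronglyMeasurable d' volume :=
    hd.1.aestronglyMeasurable.indicator measurableSet_Ici
  obtain ⟨y, hyc, hy⟩ := hT.exists_mild_solution
    (G := fun s z => F (radialRetraction R z) (d' s)) (B := B) (L := L * 2)
    (fun s z => hB _ _ (norm_radialRetraction_le hR z) (hd' s)) (by positivity)
    (fun s z z' => by
      refine (hL _ _ _ (norm_radialRetraction_le hR z) (norm_radialRetraction_le hR z')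
        (hd' s)).trans ?_
      rw [mul_assoc]
      exact mul_le_mul_of_nonneg_left (norm_radialRetraction_sub_le hR z z') hL0.le)
    (fun y hy => hFc.comp_aestronglyMeasurable
      (((continuous_radialRetraction hR).comp hy).aestronglyMeasurable.prodMk hdm)) x
  refine ⟨y, hyc, by simpa [hT.1] using hy 0 le_rfl, fun t ht hyR => ?_⟩
  rw [hy t ht]
  congr 1
  refine intervalIntegral.integral_congr fun s hs => ?_
  rw [uIcc_of_le ht] at hs
  simp only [radialRetraction_of_norm_le hR (hyR s hs), d', indicator_of_mem (mem_Ici.2 hs.1)]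

/-- By causality, the ISS estimate on `[0,t]` only depends on the input on `[0,t]`. -/
theorem norm_mild_solution_le_of_iss {f : X → U → X} (hT : IsC0Semigroup T)
    (hf : BiLipschitzOnBounded f)
    (hfc : ∀ (x : X) (u : ℝ → U), AdmissibleInput u → ∃ y, IsMildSolution T f x u y)
    {β : ℝ → ℝ → ℝ} {γ : ℝ → ℝ} (hγ : ClassK γ)
    (hiss : ∀ (x : X) (u : ℝ → U) (y : ℝ → X), AdmissibleInput u → IsMildSolution T f x u y →
      ∀ t : ℝ, 0 ≤ t → ‖y t‖ ≤ β ‖x‖ t + γ (supNorm u))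
    {x : X} {u : ℝ → U} {y : ℝ → X} {t c : ℝ} (hyc : Continuous y) (hu : PiecewiseContinuous u)
    (ht : 0 ≤ t) (hc : ∀ s ∈ Icc 0 t, ‖u s‖ ≤ c)
    (hy : ∀ s ∈ Icc 0 t, y s = T s x + ∫ σ in (0 : ℝ)..s, T (s - σ) (f (y σ) (u σ))) :
    ‖y t‖ ≤ β ‖x‖ t + γ c := by
  have hc0 : 0 ≤ c := (norm_nonneg _).trans (hc t ⟨ht, le_rfl⟩)
  set v := (Icc 0 t).indicator u
  have hv : ∀ s, ‖v s‖ ≤ c := fun s => by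
    by_cases hs : s ∈ Icc 0 t
    · simpa [v, indicator_of_mem hs] using hc s hs
    · simpa [v, indicator_of_notMem hs] using hc0
  have hvu : ∀ s ∈ Icc 0 t, v s = u s := fun s hs => indicator_of_mem hs u
  have hvp : PiecewiseContinuous v := hu.indicator_Icc 0 t
  have hva : AdmissibleInput v := ⟨hvp, c, fun s _ => hv s⟩
  obtain ⟨z₀, hz₀⟩ := hfc x v hva
  obtain ⟨hzc, hz⟩ := hz₀.comp_max
  set z := fun s => z₀ (max s 0)
  obtain ⟨C₁, hC₁⟩ := (isCompact_Icc (a := 0) (b := t)).exists_bound_of_continuousOn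
    hyc.continuousOn
  obtain ⟨C₂, hC₂⟩ := (isCompact_Icc (a := 0) (b := t)).exists_bound_of_continuousOn
    hzc.continuousOn
  obtain ⟨B₁, hB₁⟩ := hf.exists_bound (max C₁ c)
  obtain ⟨B₂, hB₂⟩ := hf.exists_bound (max C₂ c)
  obtain ⟨L, -, hL⟩ := hf.1 (max (max C₁ C₂) 1) (by positivity)
  have hyz : y t = z t := by
    refine hT.mild_solution_unique (a := t) (L := L) (C₁ := B₁) (C₂ := B₂)
      (h₁ := fun s => f (y s) (u s)) (h₂ := fun s => f (z s) (v s)) hyc hzc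
      (hf.continuous.comp_aestronglyMeasurable
        (hyc.aestronglyMeasurable.prodMk hu.aestronglyMeasurable))
      (hf.continuous.comp_aestronglyMeasurable
        (hzc.aestronglyMeasurable.prodMk hvp.aestronglyMeasurable))
      (fun s hs => hB₁ _ _ ((hC₁ s hs).trans (le_max_left _ _))
        ((hc s hs).trans (le_max_right _ _)))
      (fun s hs => hB₂ _ _ ((hC₂ s hs).trans (le_max_left _ _)) ((hv s).trans (le_max_right _ _)))
      hy (fun s hs => hz.2.2 s hs.1) (fun s hs => ?_) t ⟨ht, le_rfl⟩
    simp only [hvu s hs]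
    exact hL _ _ ((hC₁ s hs).trans (by simp)) ((hC₂ s hs).trans (by simp)) _
  rw [hyz]
  refine (hiss x v z hva hz t ht).trans ?_
  gcongr
  exact hγ.2.1.monotoneOn (Real.iSup_nonneg fun _ => norm_nonneg _) hc0 (ciSup_le fun s => hv s)

end ClosedLoop

/-- If `ẋ = Ax + f(x,u)` with `f` bi-Lipschitz on bounded sets is ISS,
then it is WURS. -/
theorem iss_implies_wurs
    {X : Type*} [NormedAddCommGroup X] [NormedSpace ℝ X] [CompleteSpace X]
    {U : Type*} [NormedAddCommGroup U] [NormedSpace ℝ U]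
    (T : ℝ → X →L[ℝ] X) (hT : IsC0Semigroup T)
    (f : X → U → X)
    (hf : BiLipschitzOnBounded f)
    (hISS : ISSProp T f) :
    WURSProp T f := by
  obtain ⟨hfc, β, γ, hβ, hγ, hiss⟩ := hISS
  have hβ0 := hβ.2.1 0 le_rfl
  -- choose a feedback gain `η` so small that the closed-loop inputs cost at most a quarter
  have hγmap : MapsTo (fun e => 4 * γ e) (Ici 0) (Ici 0) := fun e he =>
    mul_nonneg zero_le_four (hγ.nonneg he)
  have hγm : MonotoneOn (fun e => 4 * γ e) (Ici 0) := fun e he e' he' h =>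
    mul_le_mul_of_nonneg_left (hγ.2.1.monotoneOn he he' h) zero_le_four
  have hα : StrictMonoOn (fun r => β r 0 + r) (Ici 0) := hβ0.2.1.add strictMonoOn_id
  obtain ⟨η, hη, hηL, hηω⟩ := exists_classKinf_lipschitz_le_inverse
    (ω := fun e => 3 / 2 * (β (4 * γ e) 0 + 4 * γ e))
    (continuousOn_const.mul ((hβ0.1.comp (continuousOn_const.mul hγ.1) hγmap).add
      (continuousOn_const.mul hγ.1)))
    (fun e he e' he' h => mul_le_mul_of_nonneg_left
      (hα.monotoneOn (hγmap he) (hγmap he') (hγm he he' h)) (by norm_num))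
    (by simp [hγ.2.2, hβ0.2.2])
  have hηmono := hη.1.2.1.monotoneOn
  set φ : X → ℝ := fun z => η ‖z‖ with hφ
  have hφ0 : ∀ z, 0 ≤ φ z := fun z => hη.1.nonneg (norm_nonneg z)
  have hφL : ∀ z z', ‖φ z - φ z'‖ ≤ ‖z - z'‖ := fun z z' =>
    (hηL _ _ (norm_nonneg z) (norm_nonneg z')).trans (abs_norm_sub_norm_le z z')
  have hφLip : LipschitzOnBoundedBalls φ := fun r _ =>
    ⟨1, one_pos, fun z z' _ _ => (hφL z z').trans_eq (one_mul _).symm⟩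
  have hφc : Continuous φ := (LipschitzWith.of_dist_le_mul (K := 1) fun z z' => by
    simpa [dist_eq_norm] using hφL z z').continuous
  have hφle : ∀ (z : X) (v : U) (C : ℝ), ‖z‖ ≤ C → ‖v‖ ≤ 1 → ‖φ z • v‖ ≤ η C := by
    intro z v C hz hv
    rw [norm_smul, Real.norm_of_nonneg (hφ0 z)]
    exact (mul_le_of_le_one_right (hφ0 z) hv).trans
      (hηmono (norm_nonneg z) ((norm_nonneg z).trans hz) hz)
  set F : X → U → X := fun z v => f z (φ z • v) with hF
  have hFc : Continuous fun p : X × U => F p.1 p.2 :=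
    hf.continuous.comp (by fun_prop : Continuous fun p : X × U => (p.1, φ p.1 • p.2))
  have hFb : ∀ C, ∃ B, ∀ z v, ‖z‖ ≤ C → ‖v‖ ≤ 1 → ‖F z v‖ ≤ B := by
    intro C
    obtain ⟨B, hB⟩ := hf.exists_bound (max C (η C))
    exact ⟨B, fun z v hz hv => hB _ _ (hz.trans (le_max_left _ _))
      ((hφle z v C hz hv).trans (le_max_right _ _))⟩
  have hFL : ∀ C, 0 < C → ∃ L, 0 < L ∧ ∀ z z' v, ‖z‖ ≤ C → ‖z'‖ ≤ C → ‖v‖ ≤ 1 →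
      ‖F z v - F z' v‖ ≤ L * ‖z - z'‖ := by
    intro C hC
    obtain ⟨L₁, hL₁0, hL₁⟩ := hf.1 C hC
    obtain ⟨L₂, hL₂0, hL₂⟩ := hf.2 (max (η C) 1) (by positivity)
    refine ⟨L₁ + L₂, by positivity, fun z z' v hz hz' hv => ?_⟩
    have h2 := hL₂ (φ z • v) (φ z' • v) ((hφle z v C hz hv).trans (le_max_left _ _))
      ((hφle z' v C hz' hv).trans (le_max_left _ _)) z'
    rw [← sub_smul, norm_smul] at h2
    calc ‖F z v - F z' v‖
        ≤ ‖f z (φ z • v) - f z' (φ z • v)‖ + ‖f z' (φ z • v) - f z' (φ z' • v)‖ :=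
          norm_sub_le_norm_sub_add_norm_sub _ _ _
      _ ≤ L₁ * ‖z - z'‖ + L₂ * (‖z - z'‖ * 1) := by
          refine add_le_add (hL₁ _ _ hz hz' _) (h2.trans ?_)
          gcongr
          exact hφL z z'
      _ = _ := by ring
  -- trajectories starting in the ball of radius `r` never leave the ball of radius `a r`
  set a : ℝ → ℝ := fun r => 3 / 2 * (β r 0 + r) with ha
  have hra : ∀ r, 0 < r → β r 0 + r / 4 < a r ∧ r < a r := fun r hr => by
    have := hβ0.nonneg hr.le
    simp only [ha]
    constructor <;> linarith
  have hγη : ∀ r, 0 < r → γ (η (a r)) ≤ r / 4 := by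
    intro r hr
    have har : 0 ≤ a r := hr.le.trans (hra r hr).2.le
    have hmem : 0 ≤ η (a r) := hη.1.nonneg har
    have h : β (4 * γ (η (a r))) 0 + 4 * γ (η (a r)) ≤ β r 0 + r := by
      have := hηω (a r) har
      simp only [ha] at this ⊢
      linarith
    have := (hα.le_iff_le (hγmap hmem) (mem_Ici.2 hr.le)).1 h
    linarith
  have hbound : ∀ (x : X) (d : ℝ → U) (y : ℝ → X) (r : ℝ), AdmissibleDisturbance d →
      Continuous y → y 0 = x → 0 < r → ‖x‖ ≤ r →
      (∀ t, 0 ≤ t → (∀ s ∈ Icc 0 t, ‖y s‖ ≤ a r) →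
        y t = T t x + ∫ s in (0 : ℝ)..t, T (t - s) (F (y s) (d s))) →
      ∀ t, 0 ≤ t → ‖y t‖ ≤ a r ∧ ‖y t‖ ≤ β r t + r / 4 := by
    intro x d y r hd hyc hy0 hr hx hy
    have hstep : ∀ t, 0 ≤ t → (∀ s ∈ Icc 0 t, ‖y s‖ ≤ a r) → ‖y t‖ ≤ β r t + r / 4 := by
      intro t ht hyt
      have hu : PiecewiseContinuous fun s => φ (y s) • d s := fun b c => by
        obtain ⟨S, hS⟩ := hd.1 b c
        exact ⟨S, fun s hs hsS => (hφc.comp hyc).continuousAt.smul (hS s hs hsS)⟩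
      refine (norm_mild_solution_le_of_iss hT hf hfc hγ hiss hyc hu ht
        (fun s hs => hφle _ _ _ (hyt s hs) (hd.2 s hs.1)) fun s hs =>
          hy s hs.1 fun σ hσ => hyt σ ⟨hσ.1, hσ.2.trans hs.2⟩).trans ?_
      exact add_le_add ((hβ.2.1 t ht).2.1.monotoneOn (norm_nonneg x) hr.le hx) (hγη r hr)
    have hlt : ∀ t, 0 ≤ t → ‖y t‖ < a r := fun t ht =>
      lt_of_forall_le_imp_lt (g := fun t => ‖y t‖) hyc.norm
        (by simpa [hy0] using hx.trans_lt (hra r hr).2) (fun t ht hyt => by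
          refine (hstep t ht hyt).trans_lt (lt_of_le_of_lt ?_ (hra r hr).1)
          have := (hβ.2.2 r hr).1.antitoneOn self_mem_Ici ht ht
          linarith) ht
    exact fun t ht => ⟨(hlt t ht).le, hstep t ht fun s hs => (hlt s hs.1).le⟩
  have hdecay : ∀ (x : X) (d : ℝ → U) (y : ℝ → X), AdmissibleDisturbance d → Continuous y →
      IsMildSolution T F x d y → ∀ t, 0 ≤ t → ‖y t‖ ≤ β ‖x‖ t + ‖x‖ / 4 := by
    intro x d y hd hyc hy t ht
    have hr : ∀ r, 0 < r → ‖x‖ ≤ r → ‖y t‖ ≤ β r t + r / 4 := fun r hr hx =>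
      (hbound x d y r hd hyc hy.1 hr hx (fun t ht _ => hy.2.2 t ht) t ht).2
    have hlim : Tendsto (fun r => β r t + r / 4) (𝓝[>] ‖x‖) (𝓝 (β ‖x‖ t + ‖x‖ / 4)) := by
      refine Tendsto.add ?_ ?_
      · exact ((hβ.2.1 t ht).1 ‖x‖ (norm_nonneg x)).mono_left
          (nhdsWithin_mono _ (Ioi_subset_Ici (norm_nonneg x)))
      · exact ((continuous_id.div_const (4 : ℝ)).tendsto ‖x‖).mono_left nhdsWithin_le_nhds
    refine ge_of_tendsto hlim ?_
    filter_upwards [self_mem_nhdsWithin] with r hxr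
    exact hr r ((norm_nonneg x).trans_lt hxr) (le_of_lt hxr)
  obtain ⟨β', hβ', hle⟩ := exists_classKL_ge_halvingIterate hβ
  have hiter : ∀ (n : ℕ) (x : X) (d : ℝ → U) (y : ℝ → X), AdmissibleDisturbance d →
      Continuous y → IsMildSolution T F x d y → ∀ t, 0 ≤ t →
      ‖y t‖ ≤ halvingIterate (fun r t => β r t + r / 4) n ‖x‖ t := by
    intro n
    induction n with
    | zero => exact hdecay
    | succ n ih =>
      intro x d y hd hyc hy t ht
      have ht2 : 0 ≤ t / 2 := by positivity
      have h := hdecay _ _ _ ⟨hd.1.comp_const_add (t / 2), fun s hs => hd.2 _ (by positivity)⟩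
        (by fun_prop) (hy.shift hT hFc hFb hd hyc ht2) (t / 2) ht2
      rw [add_halves] at h
      have hn := ih x d y hd hyc hy (t / 2) ht2
      refine h.trans (add_le_add ?_ (by linarith))
      exact (hβ.2.1 _ ht2).2.1.monotoneOn (norm_nonneg _) ((norm_nonneg _).trans hn) hn
  refine ⟨φ, η, β', hφ0, hφLip, hη,
    fun z => le_rfl, hβ', fun x d hd => ⟨?_, fun y hy t ht => ?_⟩⟩
  · set r := ‖x‖ + 1
    have hr : 0 < r := by positivity
    obtain ⟨y, hyc, hy0, hy⟩ := exists_mild_solution_until_exit hT hFc hFb hFL hd x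
      (hr.trans (hra r hr).2)
    have hya := hbound x d y r hd hyc hy0 hr (by simp [r]) hy
    exact ⟨y, hy0, hyc.continuousOn, fun t ht => hy t ht fun s hs => (hya s hs.1).1⟩
  · obtain ⟨hyc, hym⟩ := hy.comp_max
    have := hle ‖x‖ t _ (norm_nonneg x) ht fun n => hiter n x d _ hd hyc hym t ht
    simpa only [max_eq_left ht] using this
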